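/- Quantitative simplices (Theorem B): For every integer d ≥ 2 and every real δ > 0 there exists a positive integer k₀ = k₀(d, δ) such that the following holds. For every E ⊆ ℤ^d with upper Banach density d*(E) ≥ δ there exists a positive integer k ≤ k₀ such that for every integer l there exist points λ₀, λ₁, …, λ_d ∈ E with det(λ₁ − λ₀, λ₂ − λ₀, …, λ_d − λ₀) = d! · k · l; that is, the set of signed volumes det(λ₁ − λ₀, …, λ_d − λ₀)/d! of d-simplices with all vertices in E contains kℤ. -/

import Mathlib

open MeasureTheory Filter
open scoped symmDiff

/-- Upper Banach density of a set `E ⊆ ℤ^d`: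
`d*(E) = limsup_N sup_t |E ∩ (Q_N + t)| / |Q_N|` where `Q_N = [-N, N]^d ∩ ℤ^d`. -/
noncomputable def upperBanachDensity (d : ℕ) (E : Set (Fin d → ℤ)) : ℝ :=
  Filter.atTop.limsup fun N : ℕ =>
    ⨆ t : Fin d → ℤ,
      ((E ∩ {x | ∀ i, |x i - t i| ≤ (N : ℤ)}).ncard : ℝ) / ((2 * N + 1 : ℝ) ^ d)

open BoundedContinuousFunction in
/-- Translation of bounded functions: `shift v f x = f (x + v)`. -/
noncomputable def shift {G : Type*} [AddCommGroup G] [TopologicalSpace G] [DiscreteTopology G]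
    (v : G) : (G →ᵇ ℝ) →ₗ[ℝ] (G →ᵇ ℝ) where
  toFun f := f.compContinuous ⟨fun x => x + v, continuous_of_discreteTopology⟩
  map_add' _ _ := rfl
  map_smul' _ _ := rfl

namespace InvariantMean

open scoped BoundedContinuousFunction
open Finset

lemma norm_smul_sum_le {V : Type*} [SeminormedAddCommGroup V] [NormedSpace ℝ V] (L : ℕ)
    (F : ℕ → V) {c : ℝ} (hc : 0 ≤ c)
    (hF : ∀ k ∈ range L, ‖F k‖ ≤ c) : ‖(L : ℝ)⁻¹ • ∑ k ∈ range L, F k‖ ≤ c := by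
  rw [norm_smul, norm_inv, Real.norm_natCast]
  rcases Nat.eq_zero_or_pos L with rfl | hL
  · simpa using hc
  · have hL' : (0 : ℝ) < L := by exact_mod_cast hL
    rw [inv_mul_le_iff₀ hL']
    simpa using norm_sum_le_of_le _ hF

variable {G : Type*} [AddCommGroup G] [TopologicalSpace G] [DiscreteTopology G]

@[simp] lemma shift_apply (v : G) (f : G →ᵇ ℝ) (x : G) : shift v f x = f (x + v) := rfl

lemma shift_shift (v w : G) (f : G →ᵇ ℝ) : shift v (shift w f) = shift (v + w) f := by
  ext x; simp [add_assoc]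

@[simp] lemma shift_zero (f : G →ᵇ ℝ) : shift 0 f = f := by ext x; simp

lemma shift_mul (v : G) (f g : G →ᵇ ℝ) : shift v (f * g) = shift v f * shift v g := rfl

lemma norm_shift_le (v : G) (f : G →ᵇ ℝ) : ‖shift v f‖ ≤ ‖f‖ :=
  (BoundedContinuousFunction.norm_le (norm_nonneg f)).2 fun x => f.norm_coe_le_norm (x + v)

/-- The average of the translates of a function by `0, v, …, (L - 1) v`. -/
noncomputable def avg (v : G) (L : ℕ) : (G →ᵇ ℝ) →ₗ[ℝ] (G →ᵇ ℝ) :=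
  (L : ℝ)⁻¹ • ∑ k ∈ range L, shift ((k : ℤ) • v)

lemma avg_apply (v : G) (L : ℕ) (f : G →ᵇ ℝ) :
    avg v L f = (L : ℝ)⁻¹ • ∑ k ∈ range L, shift ((k : ℤ) • v) f := by
  simp [avg]

lemma avg_shift (v w : G) (L : ℕ) (f : G →ᵇ ℝ) :
    avg v L (shift w f) = shift w (avg v L f) := by
  simp only [avg_apply, map_smul, map_sum, shift_shift, add_comm]

lemma avg_avg (v w : G) (L L' : ℕ) (f : G →ᵇ ℝ) :
    avg v L (avg w L' f) = avg w L' (avg v L f) := by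
  rw [avg_apply w, avg_apply w, map_smul, map_sum]
  simp only [avg_shift]

lemma norm_avg_le (v : G) (L : ℕ) (f : G →ᵇ ℝ) : ‖avg v L f‖ ≤ ‖f‖ := by
  rw [avg_apply]
  exact norm_smul_sum_le L _ (norm_nonneg f) fun k _ => norm_shift_le _ f

lemma norm_avg_shift_sub_le_nat (v : G) (L q : ℕ) (f : G →ᵇ ℝ) :
    ‖avg v L (shift ((q : ℤ) • v) f - f)‖ ≤ 2 * q / L * ‖f‖ := by
  induction q generalizing f with
  | zero => simp
  | succ q ih =>
    have hstep : ‖avg v L (shift v f - f)‖ ≤ 2 / L * ‖f‖ := by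
      have htel : ∑ k ∈ range L, shift ((k : ℤ) • v) (shift v f - f)
          = shift ((L : ℤ) • v) f - f := by
        have h := sum_range_sub (fun k : ℕ => shift ((k : ℤ) • v) f) L
        simp only [Nat.cast_zero, zero_smul, shift_zero] at h
        rw [← h]
        refine sum_congr rfl fun k _ => ?_
        rw [map_sub, shift_shift]
        push_cast
        rw [add_smul, one_smul]
      rw [avg_apply, htel, norm_smul, norm_inv, Real.norm_natCast]
      have h2 : ‖shift ((L : ℤ) • v) f - f‖ ≤ 2 * ‖f‖ :=
        (norm_sub_le _ _).trans (by linarith [norm_shift_le ((L : ℤ) • v) f])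
      calc (L : ℝ)⁻¹ * ‖shift ((L : ℤ) • v) f - f‖ ≤ (L : ℝ)⁻¹ * (2 * ‖f‖) := by gcongr
        _ = _ := by ring
    have hsplit : shift (((q + 1 : ℕ) : ℤ) • v) f - f
        = (shift ((q : ℤ) • v) (shift v f) - shift v f) + (shift v f - f) := by
      rw [shift_shift]; push_cast; rw [add_smul, one_smul]; abel
    rw [hsplit, map_add]
    calc _ ≤ _ := norm_add_le _ _
      _ ≤ 2 * q / L * ‖f‖ + 2 / L * ‖f‖ := by
          refine add_le_add ((ih _).trans ?_) hstep
          gcongr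
          exact norm_shift_le v f
      _ = _ := by push_cast; ring

lemma norm_avg_shift_sub_le (v : G) (L : ℕ) (q : ℤ) (f : G →ᵇ ℝ) :
    ‖avg v L (shift (q • v) f - f)‖ ≤ 2 * |(q : ℝ)| / L * ‖f‖ := by
  obtain ⟨n, rfl | rfl⟩ := q.eq_nat_or_neg
  · simpa using norm_avg_shift_sub_le_nat v L n f
  · have h := norm_avg_shift_sub_le_nat v L n (shift ((-(n : ℤ)) • v) f)
    rw [shift_shift, ← add_smul, add_neg_cancel, zero_smul, shift_zero, ← neg_sub, map_neg,
      norm_neg] at h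
    refine h.trans ?_
    push_cast
    rw [abs_neg, Nat.abs_cast]
    gcongr
    exact norm_shift_le _ f

lemma norm_map_sub_avg_le (R : (G →ᵇ ℝ) →ₗ[ℝ] (G →ᵇ ℝ)) (v : G) {L : ℕ} (hL : 0 < L)
    (f : G →ᵇ ℝ) {c : ℝ} (hc : 0 ≤ c)
    (h : ∀ k ∈ range L, ‖R (f - shift ((k : ℤ) • v) f)‖ ≤ c) : ‖R (f - avg v L f)‖ ≤ c := by
  have hL' : (L : ℝ) ≠ 0 := by exact_mod_cast hL.ne'
  have : f - avg v L f = (L : ℝ)⁻¹ • ∑ k ∈ range L, (f - shift ((k : ℤ) • v) f) := by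
    rw [sum_sub_distrib, smul_sub, avg_apply, sum_const, card_range, ← Nat.cast_smul_eq_nsmul ℝ,
      smul_smul, inv_mul_cancel₀ hL', one_smul]
  rw [this, map_smul, map_sum]
  exact norm_smul_sum_le L _ hc h

end InvariantMean

/-- A translation invariant mean on the bounded functions on a discrete abelian group. -/
structure InvariantMean (G : Type*) [AddCommGroup G] [TopologicalSpace G]
    [DiscreteTopology G] where
  /-- The underlying linear functional. -/
  toFun : (BoundedContinuousFunction G ℝ) →ₗ[ℝ] ℝ
  map_nonneg : ∀ f, (∀ x, 0 ≤ f x) → 0 ≤ toFun f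
  map_one : toFun 1 = 1
  map_shift : ∀ v f, toFun (shift v f) = toFun f

namespace InvariantMean

open scoped BoundedContinuousFunction
open Finset

variable {G : Type*} [AddCommGroup G] [TopologicalSpace G] [DiscreteTopology G]
  (Λ : InvariantMean G)

lemma mono {f g : G →ᵇ ℝ} (h : ∀ x, f x ≤ g x) : Λ.toFun f ≤ Λ.toFun g := by
  have := Λ.map_nonneg (g - f) fun x => by simpa using h x
  rwa [map_sub, sub_nonneg] at this

lemma le_norm (f : G →ᵇ ℝ) : Λ.toFun f ≤ ‖f‖ := by
  have h := Λ.mono (f := f) (g := ‖f‖ • 1) fun x => by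
    simpa using (le_abs_self _).trans (f.norm_coe_le_norm x)
  simpa [Λ.map_one] using h

lemma abs_le_norm (f : G →ᵇ ℝ) : |Λ.toFun f| ≤ ‖f‖ :=
  abs_le'.2 ⟨Λ.le_norm f, by simpa using Λ.le_norm (-f)⟩

lemma abs_mul_le (f g : G →ᵇ ℝ) : |Λ.toFun (f * g)| ≤ ‖f‖ * ‖g‖ :=
  (Λ.abs_le_norm _).trans (norm_mul_le f g)

lemma mul_self_nonneg (f : G →ᵇ ℝ) : 0 ≤ Λ.toFun (f * f) :=
  Λ.map_nonneg _ fun x => _root_.mul_self_nonneg (f x)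

lemma sq_le_mul_self (f : G →ᵇ ℝ) : Λ.toFun f ^ 2 ≤ Λ.toFun (f * f) := by
  have h := Λ.mul_self_nonneg (f - Λ.toFun f • 1)
  have e : (f - Λ.toFun f • 1) * (f - Λ.toFun f • 1)
      = f * f - (2 * Λ.toFun f) • f + (Λ.toFun f ^ 2) • (1 : G →ᵇ ℝ) := by
    ext x; simp; ring
  rw [e] at h
  simp only [map_add, map_sub, map_smul, smul_eq_mul, Λ.map_one] at h
  linarith

lemma shift_mul_eq (v : G) (f g : G →ᵇ ℝ) :
    Λ.toFun (shift v f * g) = Λ.toFun (f * shift (-v) g) := by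
  rw [← Λ.map_shift v (f * _), shift_mul, shift_shift, add_neg_cancel, shift_zero]

lemma map_avg (v : G) {L : ℕ} (hL : 0 < L) (f : G →ᵇ ℝ) :
    Λ.toFun (avg v L f) = Λ.toFun f := by
  have hL' : (L : ℝ) ≠ 0 := by exact_mod_cast hL.ne'
  simp [avg_apply, Λ.map_shift, hL']

lemma avg_mul_eq (v : G) (L : ℕ) (f g : G →ᵇ ℝ) :
    Λ.toFun (avg v L f * g) = Λ.toFun (f * avg (-v) L g) := by
  simp only [avg_apply, smul_mul_assoc, mul_smul_comm, sum_mul, mul_sum, map_smul, map_sum,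
    shift_mul_eq, smul_neg]

lemma avg_nonneg (v : G) (L : ℕ) {f : G →ᵇ ℝ} (hf : ∀ x, 0 ≤ f x) (x : G) :
    0 ≤ avg v L f x := by
  simp only [avg_apply, BoundedContinuousFunction.coe_smul, BoundedContinuousFunction.coe_sum,
    Finset.sum_apply, shift_apply, smul_eq_mul]
  exact mul_nonneg (by positivity) (sum_nonneg fun _ _ => hf _)

/-- Vectors which correlate uniformly with a fixed one cannot be almost orthogonal. -/
lemma exists_correlated {ι : Type*} [DecidableEq ι] (s : Finset ι) (z : ι → (G →ᵇ ℝ))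
    (h : G →ᵇ ℝ) {α C : ℝ} (hα : 0 < α) (hh : Λ.toFun (h * h) ≤ 1)
    (hz : ∀ i ∈ s, α ≤ Λ.toFun (z i * h)) (hC : ∀ i ∈ s, Λ.toFun (z i * z i) ≤ C)
    (hs : 2 * C < (#s : ℝ) * α ^ 2) (hs0 : s.Nonempty) :
    ∃ i ∈ s, ∃ j ∈ s, i ≠ j ∧ α ^ 2 / 2 ≤ Λ.toFun (z i * z j) := by
  by_contra! hcon
  set Z := ∑ i ∈ s, z i
  set n : ℝ := (#s : ℝ)
  have hn : 0 < n := by simpa [n] using hs0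
  have h1 : n * α ≤ Λ.toFun (Z * h) := by
    simp only [Z, sum_mul, map_sum]
    simpa [n] using card_nsmul_le_sum s _ _ hz
  have h2 := Λ.mul_self_nonneg (Z - (n * α) • h)
  have e : (Z - (n * α) • h) * (Z - (n * α) • h)
      = Z * Z - (2 * (n * α)) • (Z * h) + ((n * α) ^ 2) • (h * h) := by
    ext x; simp; ring
  rw [e] at h2
  simp only [map_add, map_sub, map_smul, smul_eq_mul] at h2
  have h3 : Λ.toFun (Z * Z) ≤ n * (C + n * (α ^ 2 / 2)) := by
    simp only [Z, sum_mul, mul_sum, map_sum]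
    have hrow : ∀ i ∈ s, ∑ j ∈ s, Λ.toFun (z i * z j) ≤ C + n * (α ^ 2 / 2) := by
      intro i hi
      rw [← add_sum_erase s _ hi]
      refine add_le_add (hC i hi) ?_
      calc ∑ j ∈ s.erase i, Λ.toFun (z i * z j) ≤ #(s.erase i) • (α ^ 2 / 2) :=
            sum_le_card_nsmul _ _ _ fun j hj =>
              (hcon i hi j (mem_of_mem_erase hj) (ne_of_mem_erase hj).symm).le
        _ ≤ n * (α ^ 2 / 2) := by
            rw [nsmul_eq_mul]
            gcongr
            exact Nat.cast_le.2 (card_le_card (erase_subset i s))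
    rw [sum_comm, ← nsmul_eq_mul]
    exact sum_le_card_nsmul s _ _ hrow
  have h4 : (n * α) ^ 2 * Λ.toFun (h * h) ≤ (n * α) ^ 2 := mul_le_of_le_one_right (by positivity) hh
  have h5 : n * α * (n * α) ≤ n * α * Λ.toFun (Z * h) := by gcongr
  nlinarith

/-- The indicator function of a set, as a bounded function. -/
noncomputable def ind {G : Type*} [TopologicalSpace G] [DiscreteTopology G] (A : Set G) :
    G →ᵇ ℝ :=
  .ofNormedAddCommGroupDiscrete (A.indicator 1) 1 fun x => by
    by_cases h : x ∈ A <;> simp [h]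

lemma ind_apply {G : Type*} [TopologicalSpace G] [DiscreteTopology G] (A : Set G) (x : G) :
    ind A x = A.indicator 1 x := rfl

lemma norm_ind_le {G : Type*} [TopologicalSpace G] [DiscreteTopology G] (A : Set G) :
    ‖ind A‖ ≤ 1 :=
  (BoundedContinuousFunction.norm_le zero_le_one).2 fun x => by
    by_cases h : x ∈ A <;> simp [ind_apply, h]

lemma ind_nonneg {G : Type*} [TopologicalSpace G] [DiscreteTopology G] (A : Set G) (x : G) :
    0 ≤ ind A x :=
  Set.indicator_nonneg (fun _ _ => zero_le_one) x

lemma ind_mul_shift_ind (A B : Set G) (v : G) :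
    ind A * shift v (ind B) = ind (A ∩ {x | x + v ∈ B}) := by
  ext x
  by_cases h : x ∈ A <;> by_cases h' : x + v ∈ B <;> simp [ind_apply, h, h']

/-- Quantitative Poincaré recurrence along multiples of `v`. -/
lemma exists_recurrence {α : ℝ} (hα : 0 < α) {n : ℕ} (hn : 2 < n * α ^ 2) (A : Set G)
    (hA : α ≤ Λ.toFun (ind A)) (v : G) :
    ∃ m : ℕ, 0 < m ∧ m < n ∧ α ^ 2 / 2 ≤ Λ.toFun (ind (A ∩ {x | x + (m : ℤ) • v ∈ A})) := by
  have hn0 : n ≠ 0 := by rintro rfl; norm_num at hn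
  obtain ⟨i, hi, j, hj, hij, h⟩ := Λ.exists_correlated (range n)
    (fun k => shift ((k : ℤ) • v) (ind A)) 1 (C := 1) hα (by simp [Λ.map_one])
    (fun k _ => by simpa [Λ.map_shift] using hA)
    (fun k _ => by
      refine (le_abs_self _).trans ((Λ.abs_mul_le _ _).trans ?_)
      have := (norm_shift_le ((k : ℤ) • v) (ind A)).trans (norm_ind_le A)
      exact mul_le_one₀ this (norm_nonneg _) this)
    (by simpa using hn) (by simpa using hn0)
  wlog hlt : i < j generalizing i j
  · exact this j hj i hi hij.symm (by rwa [mul_comm]) (by omega)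
  rw [shift_mul_eq, shift_shift, ← neg_smul, ← add_smul, ind_mul_shift_ind] at h
  refine ⟨j - i, by omega, by have := mem_range.1 hj; omega, ?_⟩
  rwa [Nat.cast_sub hlt.le, sub_eq_neg_add]

/-- Simultaneous recurrence in finitely many directions. -/
lemma exists_multi_recurrence {ι : Type*} [DecidableEq ι] (J : Finset ι) {α : ℝ} (hα : 0 < α) :
    ∃ N : ℕ, ∃ β : ℝ, 0 < β ∧
      ∀ {G : Type} [AddCommGroup G] [TopologicalSpace G] [DiscreteTopology G]
        (Λ : InvariantMean G) (A : Set G) (v : ι → G), α ≤ Λ.toFun (ind A) →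
        ∃ m : ι → ℕ, ∃ A' ⊆ A, (∀ j ∈ J, 0 < m j ∧ m j ≤ N) ∧
          (∀ x ∈ A', ∀ j ∈ J, x + (m j : ℤ) • v j ∈ A) ∧ β ≤ Λ.toFun (ind A') := by
  induction J using Finset.induction_on with
  | empty => exact ⟨0, α, hα, fun Λ A v h => ⟨0, A, subset_rfl, by simp, by simp, h⟩⟩
  | insert a J ha ih =>
    obtain ⟨N, β, hβ, H⟩ := ih
    obtain ⟨n, hn⟩ := exists_nat_gt (2 / β ^ 2)
    rw [div_lt_iff₀ (by positivity)] at hn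
    refine ⟨max N n, β ^ 2 / 2, by positivity, fun Λ A v h => ?_⟩
    obtain ⟨m, A', hA', hm, hmem, hβ'⟩ := H Λ A v h
    obtain ⟨k, hk0, hkn, hk⟩ := Λ.exists_recurrence hβ hn A' hβ' (v a)
    refine ⟨Function.update m a k, _, Set.inter_subset_left.trans hA', ?_, ?_, hk⟩
    · intro j hj
      rcases eq_or_ne j a with rfl | hne
      · simpa using ⟨hk0, Or.inr hkn.le⟩
      · have := hm j (mem_of_mem_insert_of_ne hj hne)
        simpa [hne] using ⟨this.1, Or.inl this.2⟩
    · rintro x ⟨hx, hx'⟩ j hj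
      rcases eq_or_ne j a with rfl | hne
      · simpa using hA' hx'
      · simpa [hne] using hmem x hx j (mem_of_mem_insert_of_ne hj hne)

/-- Averages along `u` and `v` nearly annihilate functions of the form `f - shift w f`, when
`w` is the difference of a multiple of `v` and a multiple of `u`. -/
lemma norm_avg_avg_sub_shift_le (u v w : G) (L : ℕ) (p q : ℤ) (hw : w = q • v - p • u)
    (f : G →ᵇ ℝ) :
    ‖avg u L (avg v L (f - shift w f))‖ ≤ 2 * (|(p : ℝ)| + |(q : ℝ)|) / L * ‖f‖ := by
  set g := shift (q • v) f
  have e : f - shift w f = -(shift (q • v) f - f) - (shift ((-p) • u) g - g) := by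
    simp only [g, shift_shift, hw]
    rw [neg_smul, neg_add_eq_sub]
    abel
  rw [e, map_sub, map_sub, avg_avg u v L L (shift ((-p) • u) g - g), map_neg, map_neg]
  have h1 := (norm_avg_le u L _).trans (norm_avg_shift_sub_le v L q f)
  have h2 := (norm_avg_le v L _).trans (norm_avg_shift_sub_le u L (-p) g)
  have h3 : ‖g‖ ≤ ‖f‖ := norm_shift_le _ f
  push_cast at h2
  rw [abs_neg] at h2
  have h4 : 2 * |(p : ℝ)| / L * ‖g‖ ≤ 2 * |(p : ℝ)| / L * ‖f‖ := by gcongr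
  refine (norm_sub_le _ _).trans ?_
  rw [norm_neg]
  calc _ ≤ 2 * |(q : ℝ)| / L * ‖f‖ + 2 * |(p : ℝ)| / L * ‖f‖ := by linarith
    _ = _ := by ring

/-- The defect of `f` from being invariant under translation by `w`, at scale `L`. -/
noncomputable def defect (w : G) (L : ℕ) (f : G →ᵇ ℝ) : G →ᵇ ℝ :=
  f - avg (-w) L (avg w L f)

lemma norm_defect_le (w : G) (L : ℕ) (f : G →ᵇ ℝ) : ‖defect w L f‖ ≤ 2 * ‖f‖ := by
  have h := (norm_avg_le (-w) L _).trans (norm_avg_le w L f)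
  exact (norm_sub_le _ _).trans (by linarith)

lemma norm_avg_avg_defect_le (u v w : G) {K : ℕ} (hK : 0 < K) (L : ℕ) (p q : ℤ)
    (hw : w = q • v - p • u) (f : G →ᵇ ℝ) :
    ‖avg u L (avg v L (defect w K f))‖ ≤ 4 * K * (|(p : ℝ)| + |(q : ℝ)|) / L * ‖f‖ := by
  have key : ∀ (w' : G) (p' q' : ℤ) (g : G →ᵇ ℝ), w' = q' • v - p' • u →
      |(p' : ℝ)| = |(p : ℝ)| → |(q' : ℝ)| = |(q : ℝ)| → ‖g‖ ≤ ‖f‖ →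
      ‖(avg u L ∘ₗ avg v L) (g - avg w' K g)‖ ≤
        2 * K * (|(p : ℝ)| + |(q : ℝ)|) / L * ‖f‖ := by
    intro w' p' q' g hw' hp' hq' hg
    refine norm_map_sub_avg_le _ w' hK g (by positivity) fun k hk => ?_
    refine (norm_avg_avg_sub_shift_le u v _ L (k * p') (k * q')
      (by rw [hw', smul_sub, smul_smul, smul_smul]) g).trans ?_
    have hkK : (k : ℝ) ≤ K := by exact_mod_cast (mem_range.1 hk).le
    push_cast
    rw [abs_mul, abs_mul, hp', hq', Nat.abs_cast, ← mul_add, ← mul_assoc]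
    gcongr
  have h1 := key w p q f hw rfl rfl le_rfl
  have h2 := key (-w) (-p) (-q) (avg w K f) (by rw [hw, neg_smul, neg_smul]; abel) (by simp)
    (by simp) (norm_avg_le w K f)
  have e : defect w K f = (f - avg w K f) + (avg w K f - avg (-w) K (avg w K f)) := by
    simp [defect]
  rw [e, map_add, map_add]
  refine (norm_add_le _ _).trans ?_
  simp only [LinearMap.comp_apply] at h1 h2
  calc _ ≤ _ := add_le_add h1 h2
    _ = _ := by ring

lemma avg_mul_avg_eq_zero (u : G) (L : ℕ) (f g : G →ᵇ ℝ)
    (h : ∀ t : ℤ, f * shift (t • u) g = 0) : avg u L f * avg u L g = 0 := by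
  simp only [avg_apply, smul_mul_assoc, mul_smul_comm, sum_mul, mul_sum]
  have : ∀ k l : ℕ, shift ((k : ℤ) • u) f * shift ((l : ℤ) • u) g = 0 := by
    intro k l
    have := congrArg (shift ((k : ℤ) • u)) (h (l - k))
    rwa [shift_mul, shift_shift, ← add_smul, add_sub_cancel, map_zero] at this
  simp only [this, sum_const_zero, smul_zero]

/-- Correlation estimate for a single direction: if `A` does not meet the translates of `E` by
`r • w + t • u`, then the mean of the product of `ind E` with a suitable function is
significantly negative. -/
lemma defect_correlation {α : ℝ} (hα : 0 < α) {A E : Set G} (hAE : A ⊆ E)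
    (hA : α ≤ Λ.toFun (ind A)) (u w : G) (r : ℤ) {K L : ℕ} (hK : 0 < K) (hL : 0 < L)
    (hrK : 2 * |(r : ℝ)| / K ≤ α ^ 2 / 2)
    (hdisj : ∀ t : ℤ, ∀ x ∈ A, x + (r • w + t • u) ∉ E) :
    α ^ 2 / 2 ≤ Λ.toFun
      (avg (-u) L (defect w K (avg u L (shift ((-r) • w) (ind A)))) * -ind E) := by
  set a := ind A
  set f := ind E
  set a' := shift ((-r) • w) a
  have hzero : avg u L a' * avg u L f = 0 := by
    refine avg_mul_avg_eq_zero u L a' f fun t => ?_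
    ext x
    simp only [a', a, f, BoundedContinuousFunction.coe_mul, Pi.mul_apply, shift_apply, ind_apply,
      BoundedContinuousFunction.coe_zero, Pi.zero_apply]
    by_cases hx : x + (-r) • w ∈ A
    · have := hdisj t _ hx
      rw [show x + (-r) • w + (r • w + t • u) = x + t • u by rw [neg_smul]; abel] at this
      simp [this]
    · rw [Set.indicator_of_notMem hx, zero_mul]
  have hlow : α ^ 2 ≤ Λ.toFun (avg w K (avg u L a) * avg w K (avg u L f)) := by
    have h0 : Λ.toFun (avg w K (avg u L a)) = Λ.toFun a := by
      rw [Λ.map_avg w hK, Λ.map_avg u hL]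
    calc α ^ 2 ≤ Λ.toFun (avg w K (avg u L a)) ^ 2 := by rw [h0]; gcongr
      _ ≤ Λ.toFun (avg w K (avg u L a) * avg w K (avg u L a)) := Λ.sq_le_mul_self _
      _ ≤ _ := Λ.mono fun x => by
          have h1 := avg_nonneg w K (avg_nonneg u L (ind_nonneg A)) x
          have h2 := avg_nonneg w K (avg_nonneg u L (f := f - a) fun x => by
            rw [BoundedContinuousFunction.coe_sub, Pi.sub_apply, sub_nonneg]
            exact Set.indicator_le_indicator_of_subset hAE (fun _ => zero_le_one) x) x
          simp only [map_sub, BoundedContinuousFunction.coe_sub, Pi.sub_apply, sub_nonneg] at h2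
          simp only [BoundedContinuousFunction.coe_mul, Pi.mul_apply]
          exact mul_le_mul_of_nonneg_left h2 h1
  have herr : |Λ.toFun (avg w K (avg u L (a' - a)) * avg w K (avg u L f))| ≤ α ^ 2 / 2 := by
    refine (Λ.abs_mul_le _ _).trans ?_
    have h1 : ‖avg w K (avg u L f)‖ ≤ 1 :=
      (norm_avg_le _ _ _).trans ((norm_avg_le _ _ _).trans (norm_ind_le E))
    have h2 : ‖avg w K (avg u L (a' - a))‖ ≤ α ^ 2 / 2 := by
      rw [avg_avg]
      refine (norm_avg_le _ _ _).trans ((norm_avg_shift_sub_le w K (-r) a).trans ?_)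
      push_cast
      rw [abs_neg]
      exact (mul_le_of_le_one_right (by positivity) (norm_ind_le A)).trans hrK
    exact (mul_le_of_le_one_right (norm_nonneg _) h1).trans h2
  have e : Λ.toFun (avg (-u) L (defect w K (avg u L a')) * -f)
      = Λ.toFun (avg w K (avg u L a') * avg w K (avg u L f)) := by
    rw [Λ.avg_mul_eq, map_neg, neg_neg, defect,
      show ∀ p q g : G →ᵇ ℝ, (p - q) * -g = q * g - p * g from fun p q g => by ext x; simp; ring,
      hzero, sub_zero, Λ.avg_mul_eq, neg_neg]
  rw [map_sub, map_sub, sub_mul, map_sub] at herr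
  rw [e]
  linarith [(abs_le.1 herr).1]

/-- Directional expansion: among sufficiently many directions `u + i • e`, there is at least one
along which `E` expands enough to meet a prescribed translate of `A i`. -/
lemma exists_direction {α : ℝ} (hα : 0 < α) {M : ℕ} (hM : 32 < M * α ^ 4) {D : ℕ}
    (hD : ∀ k : ℕ, 0 < k → k < M → k ∣ D) (E : Set G) (A : ℕ → Set G) (hAE : ∀ i, A i ⊆ E)
    (hA : ∀ i, α ≤ Λ.toFun (ind (A i))) (u e : G) (r : ℕ → ℤ) :
    ∃ i < M, ∃ t : ℤ, ∃ x ∈ A i,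
      x + (r i • ((D : ℤ) • e) + t • (u + (i : ℤ) • e)) ∈ E := by
  by_contra! hcon
  set w := (D : ℤ) • e
  obtain ⟨K, hK0, hK⟩ : ∃ K : ℕ, 0 < K ∧ ∀ i < M, 2 * |(r i : ℝ)| / K ≤ α ^ 2 / 2 := by
    obtain ⟨K, hK⟩ := exists_nat_gt ((∑ i ∈ range M, 2 * |(r i : ℝ)|) / (α ^ 2 / 2))
    have hK0 : (0 : ℝ) < K := lt_of_le_of_lt (by positivity) hK
    refine ⟨K, by exact_mod_cast hK0, fun i hi => ?_⟩
    rw [div_lt_iff₀ (by positivity)] at hK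
    rw [div_le_iff₀ hK0]
    exact (single_le_sum (f := fun i => 2 * |(r i : ℝ)|) (fun _ _ => by positivity)
      (mem_range.2 hi)).trans hK.le |>.trans (mul_comm _ _).le
  obtain ⟨L, hL0, hL⟩ : ∃ L : ℕ, 0 < L ∧ 2 * (8 * K * D / L) < (α ^ 2 / 2) ^ 2 / 2 := by
    obtain ⟨L, hL⟩ := exists_nat_gt (2 * (8 * K * D) / ((α ^ 2 / 2) ^ 2 / 2))
    have hL0 : (0 : ℝ) < L := lt_of_le_of_lt (by positivity) hL
    refine ⟨L, by exact_mod_cast hL0, ?_⟩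
    rw [div_lt_iff₀ (by positivity)] at hL
    rw [← mul_div_assoc, div_lt_iff₀ hL0]
    linarith
  set d : ℕ → G := fun i => u + (i : ℤ) • e
  set y : ℕ → (G →ᵇ ℝ) := fun i => avg (d i) L (shift ((-r i) • w) (ind (A i)))
  have hy : ∀ i, ‖y i‖ ≤ 1 := fun i =>
    (norm_avg_le _ _ _).trans ((norm_shift_le _ _).trans (norm_ind_le _))
  have hdy : ∀ i, ‖defect w K (y i)‖ ≤ 2 := fun i =>
    (norm_defect_le _ _ _).trans (by linarith [hy i])
  have hz : ∀ i, ‖avg (-d i) L (defect w K (y i))‖ ≤ 2 := fun i =>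
    (norm_avg_le _ _ _).trans (hdy i)
  have hM0 : M ≠ 0 := by rintro rfl; norm_num at hM
  obtain ⟨i, hi, j, hj, hij, h⟩ := Λ.exists_correlated (range M)
    (fun i => avg (-d i) L (defect w K (y i))) (-ind E) (α := α ^ 2 / 2) (C := 4) (by positivity)
    ((le_abs_self _).trans ((Λ.abs_mul_le _ _).trans
      (by rw [norm_neg]; exact mul_le_one₀ (norm_ind_le E) (norm_nonneg _) (norm_ind_le E))))
    (fun i hi => Λ.defect_correlation hα (hAE i) (hA i) (d i) w (r i) hK0 hL0
      (hK i (mem_range.1 hi)) fun t x hx => hcon i (mem_range.1 hi) t x hx)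
    (fun i _ => (le_abs_self _).trans ((Λ.abs_mul_le _ _).trans
      ((mul_le_mul (hz i) (hz i) (norm_nonneg _) zero_le_two).trans (by norm_num))))
    (by rw [card_range]; nlinarith) (by simpa using hM0)
  wlog hlt : i < j generalizing i j
  · exact this j hj i hi hij.symm (by rwa [mul_comm]) (by omega)
  obtain ⟨q, hq⟩ := hD (j - i) (by omega) (by have := mem_range.1 hj; omega)
  have hw : w = (q : ℤ) • d j - (q : ℤ) • d i := by
    have hq' : (D : ℤ) = q * ((j : ℤ) - i) := by
      rw [hq]; push_cast [Nat.cast_sub hlt.le]; ring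
    simp only [w, d, hq']
    rw [← smul_sub, add_sub_add_left_eq_sub, ← sub_smul, smul_smul]
  have hqD : (q : ℝ) ≤ D := by
    have : q ≤ D := by rw [hq]; exact Nat.le_mul_of_pos_left _ (by omega)
    exact_mod_cast this
  refine absurd h (not_le.2 (lt_of_le_of_lt ?_ hL))
  rw [Λ.avg_mul_eq, neg_neg]
  refine (le_abs_self _).trans ((Λ.abs_mul_le _ _).trans ?_)
  have hsmall := norm_avg_avg_defect_le (d i) (-d j) w hK0 L q (-q) (by rw [hw]; simp) (y j)
  refine mul_le_mul (hdy i) (hsmall.trans ?_) (norm_nonneg _) zero_le_two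
  push_cast
  rw [abs_neg, Nat.abs_cast]
  calc 4 * (K : ℝ) * (q + q) / L * ‖y j‖ ≤ 4 * (K : ℝ) * (D + D) / L * 1 := by
        gcongr
        exact hy j
    _ = _ := by ring

section Existence

open Topology

/-- The box `[-N, N]^d + t`. -/
noncomputable def box (d N : ℕ) (t : Fin d → ℤ) : Finset (Fin d → ℤ) :=
  Fintype.piFinset fun i => Finset.Icc (t i - N) (t i + N)

lemma mem_box {d N : ℕ} {t x : Fin d → ℤ} : x ∈ box d N t ↔ ∀ i, |x i - t i| ≤ N := by
  simp only [box, Fintype.mem_piFinset, Finset.mem_Icc, abs_le]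
  exact forall_congr' fun i => ⟨fun h => ⟨by linarith, by linarith⟩,
    fun h => ⟨by linarith, by linarith⟩⟩

lemma card_box (d N : ℕ) (t : Fin d → ℤ) : ((box d N t).card : ℝ) = (2 * N + 1 : ℝ) ^ d := by
  have h : ∀ i, (Finset.Icc (t i - N) (t i + N)).card = 2 * N + 1 := fun i => by
    rw [Int.card_Icc]; omega
  simp [box, Fintype.card_piFinset, h]

/-- The average of a function over the box `[-N, N]^d + t`. -/
noncomputable def boxAvg (d N : ℕ) (t : Fin d → ℤ) (f : (Fin d → ℤ) →ᵇ ℝ) : ℝ :=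
  (∑ x ∈ box d N t, f x) / (2 * N + 1 : ℝ) ^ d

lemma abs_boxAvg_le (d N : ℕ) (t : Fin d → ℤ) (f : (Fin d → ℤ) →ᵇ ℝ) :
    |boxAvg d N t f| ≤ ‖f‖ := by
  have hpos : (0 : ℝ) < (2 * N + 1 : ℝ) ^ d := by positivity
  rw [boxAvg, abs_div, abs_of_pos hpos, div_le_iff₀ hpos, ← card_box d N t, mul_comm,
    ← nsmul_eq_mul]
  exact (abs_sum_le_sum_abs _ _).trans (sum_le_card_nsmul _ _ _ fun x _ => f.norm_coe_le_norm x)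

lemma boxAvg_shift_le (d N r : ℕ) (t v : Fin d → ℤ) (hv : ∀ i, |v i| ≤ r)
    (f : (Fin d → ℤ) →ᵇ ℝ) (hf : ∀ x, 0 ≤ f x) :
    boxAvg d N t (shift v f) ≤
      boxAvg d N t f + ‖f‖ * (((2 * (N + r) + 1) / (2 * N + 1) : ℝ) ^ d - 1) := by
  have hpos : (0 : ℝ) < (2 * N + 1 : ℝ) ^ d := by positivity
  have hsub : box d N t ⊆ box d (N + r) t := fun x hx => mem_box.2 fun i =>
    (mem_box.1 hx i).trans (by push_cast; linarith [abs_nonneg (v i), hv i])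
  have h1 : ∑ x ∈ box d N t, shift v f x ≤ ∑ x ∈ box d (N + r) t, f x := by
    simp only [shift_apply]
    rw [← sum_image (f := fun x => f x) (g := fun x => x + v) fun x _ y _ h => add_right_cancel h]
    refine sum_le_sum_of_subset_of_nonneg ?_ fun x _ _ => hf x
    intro y hy
    obtain ⟨x, hx, rfl⟩ := mem_image.1 hy
    refine mem_box.2 fun i => ?_
    have := abs_add_le (x i - t i) (v i)
    rw [Pi.add_apply, show x i + v i - t i = x i - t i + v i by ring]
    push_cast
    linarith [mem_box.1 hx i, hv i]
  have h2 : ∑ x ∈ box d (N + r) t \ box d N t, f x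
      ≤ ‖f‖ * ((2 * (N + r) + 1 : ℝ) ^ d - (2 * N + 1 : ℝ) ^ d) := by
    have hc : ((box d (N + r) t \ box d N t).card : ℝ)
        = (2 * (N + r) + 1 : ℝ) ^ d - (2 * N + 1 : ℝ) ^ d := by
      rw [cast_card_sdiff hsub, card_box, card_box]; push_cast; rfl
    rw [← hc, mul_comm, ← nsmul_eq_mul]
    exact sum_le_card_nsmul _ _ _ fun x _ => (le_abs_self _).trans (f.norm_coe_le_norm x)
  rw [← sum_sdiff hsub] at h1
  rw [boxAvg, boxAvg, div_pow, div_le_iff₀ hpos]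
  have e : (∑ x ∈ box d N t, f x) / (2 * N + 1 : ℝ) ^ d +
      ‖f‖ * ((2 * (N + r) + 1 : ℝ) ^ d / (2 * N + 1 : ℝ) ^ d - 1)
      = (∑ x ∈ box d N t, f x + ‖f‖ * ((2 * (N + r) + 1 : ℝ) ^ d - (2 * N + 1 : ℝ) ^ d))
        / (2 * N + 1 : ℝ) ^ d := by
    field_simp
  rw [e, div_mul_cancel₀ _ hpos.ne']
  linarith

lemma tendsto_box_ratio (d r : ℕ) :
    Tendsto (fun N : ℕ => ((2 * (N + r) + 1) / (2 * N + 1) : ℝ) ^ d - 1) atTop (𝓝 0) := by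
  have h : Tendsto (fun N : ℕ => (1 : ℝ) + (2 * r) / (2 * N + 1)) atTop (𝓝 (1 + 0)) := by
    refine tendsto_const_nhds.add (Tendsto.const_div_atTop ?_ _)
    exact tendsto_atTop_add_const_right _ _
      (tendsto_natCast_atTop_atTop.const_mul_atTop zero_lt_two)
  have h' := (h.pow d).sub_const 1
  rw [add_zero, one_pow, sub_self] at h'
  refine h'.congr fun N => ?_
  have : (2 * N + 1 : ℝ) ≠ 0 := by positivity
  congr 2
  field_simp
  ring

/-- A generalized limit of the averages over a sequence of growing boxes is an invariant mean. -/
lemma exists_of_boxes (d : ℕ) (φ : ℕ → ℕ) (hφ : Tendsto φ atTop atTop) (t : ℕ → Fin d → ℤ) :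
    ∃ Λ : InvariantMean (Fin d → ℤ), ∀ (f : (Fin d → ℤ) →ᵇ ℝ) (c : ℝ),
      (∀ n, c ≤ boxAvg d (φ n) (t n) f) → c ≤ Λ.toFun f := by
  set U := hyperfilter ℕ
  have hU : (U : Filter ℕ) ≤ atTop := Nat.hyperfilter_le_atTop
  have hlim : ∀ f : (Fin d → ℤ) →ᵇ ℝ, ∃ c : ℝ,
      Tendsto (fun n => boxAvg d (φ n) (t n) f) U (𝓝 c) := by
    intro f
    obtain ⟨c, -, hc⟩ := (isCompact_Icc (a := -‖f‖) (b := ‖f‖)).ultrafilter_le_nhds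
      (U.map fun n => boxAvg d (φ n) (t n) f)
      (le_principal_iff.2 <| mem_map.2 <| Filter.univ_mem' fun n =>
        abs_le.1 (abs_boxAvg_le d (φ n) (t n) f))
    exact ⟨c, hc⟩
  choose Λ hΛ using hlim
  have hge : ∀ (f : (Fin d → ℤ) →ᵇ ℝ) (c : ℝ),
      (∀ n, c ≤ boxAvg d (φ n) (t n) f) → c ≤ Λ f := fun f c h =>
    ge_of_tendsto' (hΛ f) h
  let Λ' : ((Fin d → ℤ) →ᵇ ℝ) →ₗ[ℝ] ℝ :=
    { toFun := Λ
      map_add' := fun f g => tendsto_nhds_unique (hΛ (f + g)) <|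
        ((hΛ f).add (hΛ g)).congr fun n => by
          simp [boxAvg, sum_add_distrib, add_div]
      map_smul' := fun c f => tendsto_nhds_unique (hΛ (c • f)) <|
        ((hΛ f).const_mul c).congr fun n => by
          simp [boxAvg, ← mul_sum, mul_div_assoc] }
  have hone : Λ' 1 = 1 := tendsto_nhds_unique (hΛ 1) <|
    tendsto_const_nhds.congr fun n => by
      have hpos : (2 * φ n + 1 : ℝ) ^ d ≠ 0 := by positivity
      simp [boxAvg, card_box, hpos]
  have hle : ∀ (v : Fin d → ℤ) (f : (Fin d → ℤ) →ᵇ ℝ), (∀ x, 0 ≤ f x) →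
      Λ' (shift v f) ≤ Λ' f := by
    intro v f hf
    set r : ℕ := ∑ i, (v i).natAbs
    have hv : ∀ i, |v i| ≤ r := fun i => by
      rw [Int.abs_eq_natAbs]
      exact_mod_cast single_le_sum (f := fun i => (v i).natAbs) (fun _ _ => Nat.zero_le _)
        (mem_univ i)
    have h := (hΛ f).add ((((tendsto_box_ratio d r).comp hφ).mono_left hU).const_mul ‖f‖)
    rw [mul_zero, add_zero] at h
    exact le_of_tendsto_of_tendsto' (hΛ _) h fun n => boxAvg_shift_le d (φ n) r (t n) v hv f hf
  have heq : ∀ (v : Fin d → ℤ) (f : (Fin d → ℤ) →ᵇ ℝ), (∀ x, 0 ≤ f x) →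
      Λ' (shift v f) = Λ' f := by
    intro v f hf
    refine (hle v f hf).antisymm ?_
    simpa [shift_shift] using hle (-v) (shift v f) fun x => hf _
  refine ⟨⟨Λ', fun f hf => hge f 0 fun n => ?_, hone, fun v f => ?_⟩, hge⟩
  · exact div_nonneg (sum_nonneg fun x _ => hf x) (by positivity)
  · have h := heq v (f + ‖f‖ • 1) fun x => by
      have := (abs_le.1 (f.norm_coe_le_norm x)).1
      simp only [BoundedContinuousFunction.coe_add, BoundedContinuousFunction.coe_smul,
        Pi.add_apply, BoundedContinuousFunction.coe_one, Pi.one_apply, smul_eq_mul, mul_one]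
      linarith
    have h1 : shift v (1 : (Fin d → ℤ) →ᵇ ℝ) = 1 := rfl
    rw [map_add, map_smul, h1, map_add, map_add] at h
    exact add_right_cancel h

/-- A set of positive upper Banach density has positive measure for some invariant mean. -/
lemma exists_of_upperBanachDensity {d : ℕ} {E : Set (Fin d → ℤ)} {δ : ℝ} (hδ : 0 < δ)
    (hE : δ ≤ upperBanachDensity d E) :
    ∃ Λ : InvariantMean (Fin d → ℤ), δ / 2 ≤ Λ.toFun (ind E) := by
  have hfreq := frequently_lt_of_lt_limsup
    (isCoboundedUnder_le_of_le atTop fun N : ℕ =>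
      Real.iSup_nonneg fun t : Fin d → ℤ => by positivity)
    ((half_lt_self hδ).trans_le hE)
  obtain ⟨φ, hφ, h⟩ := extraction_of_frequently_atTop hfreq
  choose t ht using fun n => exists_lt_of_lt_ciSup (h n)
  obtain ⟨Λ, hΛ⟩ := exists_of_boxes d φ hφ.tendsto_atTop t
  refine ⟨Λ, hΛ _ _ fun n => (ht n).le.trans_eq ?_⟩
  classical
  have hset : E ∩ {x | ∀ i, |x i - t n i| ≤ (φ n : ℤ)}
      = ((box d (φ n) (t n)).filter (· ∈ E) : Finset (Fin d → ℤ)) := by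
    ext x; simp [mem_box, and_comm]
  rw [boxAvg, hset, Set.ncard_coe_finset]
  congr 1
  simp [ind_apply, Set.indicator_apply]

end Existence

end InvariantMean

/-- The determinant of a diagonal matrix modified by two shears. -/
lemma det_sheared_diagonal (n : ℕ) (m : Fin (n + 2) → ℤ) (s t c : ℤ) :
    (Matrix.of fun a j : Fin (n + 2) => (if j = 1 then
      s • Pi.single 1 1 + t • (Pi.single 0 1 + c • Pi.single 1 1)
      else m j • (if j = 0 then Pi.single 0 1 + c • Pi.single 1 1 else Pi.single j 1) :
        Fin (n + 2) → ℤ) a).det = (∏ j ∈ Finset.univ.erase 1, m j) * s := by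
  set W : Matrix (Fin (n + 2)) (Fin (n + 2)) ℤ := Matrix.of fun a j =>
    (if j = 1 then s • Pi.single 1 1 + t • Pi.single 0 1 else m j • Pi.single j 1 :
      Fin (n + 2) → ℤ) a
  have hM : (Matrix.of fun a j : Fin (n + 2) => (if j = 1 then
      s • Pi.single 1 1 + t • (Pi.single 0 1 + c • Pi.single 1 1)
      else m j • (if j = 0 then Pi.single 0 1 + c • Pi.single 1 1 else Pi.single j 1) :
        Fin (n + 2) → ℤ) a) = W.updateRow 1 (W 1 + c • W 0) := by
    ext a j
    by_cases ha : a = 1 <;> by_cases hj : j = 1 <;> by_cases hj0 : j = 0 <;>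
      simp_all [W, Matrix.updateRow_apply, Pi.single_apply] <;> ring
  rw [hM, Matrix.det_updateRow_add_smul_self _ (by simp), Matrix.det_of_isUpperTriangular,
    ← Finset.mul_prod_erase _ _ (Finset.mem_univ 1), mul_comm]
  · congr 1
    · refine Finset.prod_congr rfl fun j hj => ?_
      simp [W, Finset.ne_of_mem_erase hj]
    · simp [W]
  · intro a j hja
    simp only [id] at hja
    by_cases hj : j = 1
    · subst hj
      have h0 : a ≠ 0 := by rintro rfl; simp at hja
      simp [W, hja.ne', h0]
    · simp [W, hj, hja.ne']

/-- **Theorem B (Quantitative simplices).** For every `d ≥ 2` and `δ > 0` there is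
`k₀ = k₀(d, δ)` such that for every `E ⊆ ℤ^d` with `d*(E) ≥ δ` there is a positive
`k ≤ k₀` such that for every `l ∈ ℤ` there are points `λ₀, …, λ_d ∈ E` with
`det(λ₁ - λ₀, …, λ_d - λ₀) = d! ⬝ k ⬝ l`. -/
theorem quantitative_simplices (d : ℕ) (hd : 2 ≤ d) (δ : ℝ) (hδ : 0 < δ) :
    ∃ k₀ : ℕ, 0 < k₀ ∧
      ∀ E : Set (Fin d → ℤ), δ ≤ upperBanachDensity d E →
        ∃ k : ℕ, 0 < k ∧ k ≤ k₀ ∧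
          ∀ l : ℤ, ∃ lam : Fin (d + 1) → (Fin d → ℤ), (∀ i, lam i ∈ E) ∧
            (Matrix.of fun i j : Fin d => lam j.succ i - lam 0 i).det
              = (d.factorial : ℤ) * (k : ℤ) * l := by
  obtain ⟨n, rfl⟩ : ∃ n, d = n + 2 := ⟨d - 2, by omega⟩
  obtain ⟨N, β, hβ, hrec⟩ := InvariantMean.exists_multi_recurrence
    (Finset.univ : Finset (Fin (n + 2))) (half_pos hδ)
  obtain ⟨M, hM⟩ := exists_nat_gt (32 / β ^ 4)
  rw [div_lt_iff₀ (by positivity)] at hM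
  set D := M.factorial
  have hk : 0 < D * N.factorial ^ (n + 1) := by positivity
  refine ⟨D * N.factorial ^ (n + 1), hk, fun E hE => ⟨_, hk, le_rfl, fun l => ?_⟩⟩
  obtain ⟨Λ, hΛ⟩ := InvariantMean.exists_of_upperBanachDensity hδ hE
  set u : Fin (n + 2) → ℤ := Pi.single 0 1
  set e : Fin (n + 2) → ℤ := Pi.single 1 1
  set v : ℕ → Fin (n + 2) → Fin (n + 2) → ℤ := fun i j =>
    if j = 0 then u + (i : ℤ) • e else Pi.single j 1
  choose m A hAE hm hmem hA using fun i => hrec Λ E (v i) hΛ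
  have hdvd : ∀ i, ∃ c : ℕ, N.factorial ^ (n + 1) = (∏ j ∈ Finset.univ.erase 1, m i j) * c := by
    intro i
    have h := Finset.prod_dvd_prod_of_dvd (s := Finset.univ.erase (1 : Fin (n + 2))) (m i)
      (fun _ => N.factorial) fun j _ =>
        Nat.dvd_factorial (hm i j (Finset.mem_univ j)).1 (hm i j (Finset.mem_univ j)).2
    rwa [Finset.prod_const, Finset.card_erase_of_mem (Finset.mem_univ _), Finset.card_univ,
      Fintype.card_fin] at h
  choose c hc using hdvd
  obtain ⟨i, -, t, x, hx, hxE⟩ := Λ.exists_direction hβ hM (D := D)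
    (fun k hk0 hkM => Nat.dvd_factorial hk0 hkM.le) E A hAE hA u e
    fun i => (n + 2).factorial * c i * l
  refine ⟨Fin.cons x fun j => x + if j = 1 then
    ((n + 2).factorial * c i * l) • ((D : ℤ) • e) + t • (u + (i : ℤ) • e)
    else (m i j : ℤ) • v i j, ?_, ?_⟩
  · intro j
    refine Fin.cases (hAE i hx) (fun j => ?_) j
    rw [Fin.cons_succ]
    split_ifs
    · exact hxE
    · exact hmem i x hx j (Finset.mem_univ j)
  · have h := det_sheared_diagonal n (fun j => m i j) ((n + 2).factorial * c i * l * D) t i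
    simp only [Fin.cons_succ, Fin.cons_zero, Pi.add_apply, add_sub_cancel_left, smul_smul]
    refine h.trans ?_
    have hc' := congrArg (Nat.cast (R := ℤ)) (hc i)
    push_cast at hc' ⊢
    rw [hc']
    ring
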